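/- For all integers m, j with 0 ≤ m < j, the bounded operator on L²(ℝ) given by [(1−Pⱼ) − χⱼ∘(1−Pⱼ)∘χⱼ] ∘ [χₘ∘Pₘ∘χₘ] has operator norm at most (1 + 15·kmax/(4·2^j))·δ₁. -/

import Mathlib

open MeasureTheory Real Complex Set Function
open scoped ENNReal

noncomputable section

/-- The error function `erf x = (2/√π) ∫₀ˣ e^{-t²} dt`. -/
def erf' (x : ℝ) : ℝ := (2 / Real.sqrt Real.pi) * ∫ t in (0:ℝ)..x, Real.exp (-t^2)

/-- The complementary error function `erfc x = 1 - erf x`. -/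
def erfc' (x : ℝ) : ℝ := 1 - erf' x

/-- The inverse of the strictly decreasing bijection `erfc' : [0,∞) → (0,1]`. -/
def erfcInv (y : ℝ) : ℝ := Function.invFunOn erfc' (Set.Ici 0) y

/-- The spatial cutoff χ₀(x) = (1/2)[erf((x+3L/4)/σ) − erf((x−3L/4)/σ)]. -/
def chi0 (L σ x : ℝ) : ℝ := (1/2) * (erf' ((x + 3*L/4)/σ) - erf' ((x - 3*L/4)/σ))

/-- The frequency cutoff P₀(k) = (1/2)[erf(σ(k+3kmax/8)) − erf(σ(k−3kmax/8))]. -/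
def P0fun (kmax σ k : ℝ) : ℝ := (1/2) * (erf' (σ*(k + 3*kmax/8)) - erf' (σ*(k - 3*kmax/8)))

/-- The scaled spatial cutoff χₘ(x) = χ₀(2^{-m} x). -/
def chiSc (L σ : ℝ) (m : ℕ) (x : ℝ) : ℝ := chi0 L σ (x / 2^m)

/-- The scaled frequency cutoff Pₘ(k) = P₀(2^m k). -/
def PSc (kmax σ : ℝ) (m : ℕ) (k : ℝ) : ℝ := P0fun kmax σ (2^m * k)

/-- Fourier transform with the convention f̂(k) = (2π)^{-1/2} ∫ f(x) e^{-ikx} dx. -/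
def ft (f : ℝ → ℂ) (k : ℝ) : ℂ :=
  (Real.sqrt (2*Real.pi) : ℂ)⁻¹ * ∫ x : ℝ, Complex.exp (-(Complex.I * k * x)) * f x

/-- Inverse Fourier transform with the convention (2π)^{-1/2} ∫ g(k) e^{ikx} dk. -/
def ift (g : ℝ → ℂ) (x : ℝ) : ℂ :=
  (Real.sqrt (2*Real.pi) : ℂ)⁻¹ * ∫ k : ℝ, Complex.exp (Complex.I * k * x) * g k

/-- The space L²(ℝ, ℂ). -/
abbrev L2 := Lp ℂ 2 (volume : Measure ℝ)

/-- `T` is the bounded Fourier multiplier operator on L² with symbol `m`: on the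
dense set of `f ∈ L¹ ∩ L²` with integrable Fourier transform, `T f = 𝓕⁻¹(m·𝓕f)`.
(This uniquely determines `T` for a bounded symbol.) -/
def IsMultOp (m : ℝ → ℝ) (T : L2 →L[ℂ] L2) : Prop :=
  ∀ f : L2, Integrable (f : ℝ → ℂ) volume → Integrable (ft (f : ℝ → ℂ)) volume →
    (T f : ℝ → ℂ) =ᵐ[volume] ift (fun k => (m k : ℂ) * ft (f : ℝ → ℂ) k)

/-- `T` is the operator of pointwise multiplication by the real function `c`. -/
def IsMulBy (c : ℝ → ℝ) (T : L2 →L[ℂ] L2) : Prop :=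
  ∀ f : L2, (T f : ℝ → ℂ) =ᵐ[volume] fun x => (c x : ℂ) * f x

lemma integrable_exp_neg_sq : Integrable (fun t : ℝ => Real.exp (-t ^ 2)) := by
  simpa using integrable_exp_neg_mul_sq (b := 1) one_pos

lemma hasDerivAt_erf' (x : ℝ) :
    HasDerivAt erf' (2 / Real.sqrt Real.pi * Real.exp (-x ^ 2)) x := by
  have hc : Continuous fun t : ℝ => Real.exp (-t ^ 2) := by fun_prop
  exact (intervalIntegral.integral_hasDerivAt_right (hc.intervalIntegrable _ _)
    (hc.stronglyMeasurableAtFilter _ _) hc.continuousAt).const_mul _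

lemma hasDerivAt_erfc' (x : ℝ) :
    HasDerivAt erfc' (-(2 / Real.sqrt Real.pi * Real.exp (-x ^ 2))) x :=
  (hasDerivAt_erf' x).const_sub 1

lemma contDiff_erf' {n : ℕ∞} : ContDiff ℝ n erf' := by
  refine ContDiff.of_le ?_ (n := ((⊤ : ℕ∞) : WithTop ℕ∞)) (by exact_mod_cast le_top)
  rw [contDiff_infty_iff_deriv]
  refine ⟨fun x => (hasDerivAt_erf' x).differentiableAt, ?_⟩
  rw [show deriv erf' = _ from funext fun x => (hasDerivAt_erf' x).deriv]
  fun_prop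

lemma erf'_neg (x : ℝ) : erf' (-x) = -erf' x := by
  have h := intervalIntegral.integral_comp_neg (a := 0) (b := x) fun t : ℝ => Real.exp (-t ^ 2)
  simp only [even_two, Even.neg_pow, neg_zero] at h
  rw [erf', erf', intervalIntegral.integral_symm, ← h, mul_neg]

lemma sqrt_pi_bounds : (177 / 100 : ℝ) < Real.sqrt Real.pi ∧ Real.sqrt Real.pi < 178 / 100 := by
  constructor
  · apply Real.lt_sqrt_of_sq_lt
    linarith [Real.pi_gt_d4]
  · rw [Real.sqrt_lt' (by norm_num)]
    linarith [Real.pi_lt_d4]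

lemma erfc'_eq_integral_Ioi (x : ℝ) :
    erfc' x = 2 / Real.sqrt Real.pi * ∫ t in Ioi x, Real.exp (-t ^ 2) := by
  have h := intervalIntegral.integral_interval_add_Ioi (a := 0) (b := x)
    integrable_exp_neg_sq.integrableOn integrable_exp_neg_sq.integrableOn
  have h0 : ∫ t in Ioi (0 : ℝ), Real.exp (-t ^ 2) = Real.sqrt Real.pi / 2 := by
    simpa using integral_gaussian_Ioi 1
  have hp : Real.sqrt Real.pi ≠ 0 := by positivity
  rw [erfc', erf', eq_sub_of_add_eq h, h0]
  field_simp
  ring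

lemma erfc'_nonneg (x : ℝ) : 0 ≤ erfc' x := by
  rw [erfc'_eq_integral_Ioi]
  have : 0 ≤ ∫ t in Ioi x, Real.exp (-t ^ 2) := integral_nonneg fun t => (Real.exp_pos _).le
  positivity

lemma erfc'_zero : erfc' 0 = 1 := by simp [erfc', erf']

lemma erfc'_strictAnti : StrictAnti erfc' :=
  strictAnti_of_hasDerivAt_neg hasDerivAt_erfc' fun x => by
    have : 0 < Real.exp (-x ^ 2) := Real.exp_pos _
    have : 0 < Real.sqrt Real.pi := by positivity
    rw [neg_lt_zero]
    positivity

lemma erfc'_neg (x : ℝ) : erfc' (-x) = 2 - erfc' x := by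
  simp only [erfc', erf'_neg]
  ring

lemma erfc'_le_exp_neg_sq {x : ℝ} (hx : 0 ≤ x) : erfc' x ≤ Real.exp (-x ^ 2) := by
  have h1 : ∫ t in Ioi x, Real.exp (-t ^ 2) = ∫ t in Ioi (0 : ℝ), Real.exp (-(t + x) ^ 2) := by
    have := (measurePreserving_add_right volume x).setIntegral_preimage_emb
      (MeasurableEquiv.addRight x).measurableEmbedding (fun t : ℝ => Real.exp (-t ^ 2)) (Ioi x)
    simpa using this.symm
  have h2 : ∫ t in Ioi (0 : ℝ), Real.exp (-(t + x) ^ 2) ≤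
      ∫ t in Ioi (0 : ℝ), Real.exp (-x ^ 2) * Real.exp (-t ^ 2) := by
    refine setIntegral_mono_on (integrable_exp_neg_sq.comp_add_right x).integrableOn
      (integrable_exp_neg_sq.const_mul _).integrableOn measurableSet_Ioi fun t ht => ?_
    rw [← Real.exp_add]
    apply Real.exp_le_exp.2
    nlinarith [mul_nonneg hx (le_of_lt (mem_Ioi.1 ht))]
  have h0 : ∫ t in Ioi (0 : ℝ), Real.exp (-t ^ 2) = Real.sqrt Real.pi / 2 := by
    simpa using integral_gaussian_Ioi 1
  have hp : 0 < Real.sqrt Real.pi := by positivity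
  rw [integral_const_mul, h0, ← h1] at h2
  rw [erfc'_eq_integral_Ioi]
  calc _ ≤ 2 / Real.sqrt Real.pi * (Real.exp (-x ^ 2) * (Real.sqrt Real.pi / 2)) := by gcongr
    _ = _ := by field_simp

lemma tendsto_erfc'_atTop : Filter.Tendsto erfc' Filter.atTop (nhds 0) := by
  refine squeeze_zero' (.of_forall erfc'_nonneg)
    (Filter.eventually_atTop.2 ⟨0, fun x hx => erfc'_le_exp_neg_sq hx⟩) ?_
  exact Real.tendsto_exp_neg_atTop_nhds_zero.comp (Filter.tendsto_pow_atTop two_ne_zero)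

/-- The elementary lower Mills-ratio bound for `erfc'`. -/
lemma le_erfc' (x : ℝ) :
    2 / Real.sqrt Real.pi * (Real.exp (-x ^ 2) * (x / (2 * x ^ 2 + 1))) ≤ erfc' x := by
  set G : ℝ → ℝ := fun y =>
    erfc' y - 2 / Real.sqrt Real.pi * (Real.exp (-y ^ 2) * (y / (2 * y ^ 2 + 1))) with hG
  have hd : ∀ y, HasDerivAt G
      (-(2 / Real.sqrt Real.pi * (Real.exp (-y ^ 2) * (2 / (2 * y ^ 2 + 1) ^ 2)))) y := by
    intro y
    have hy : (2 * y ^ 2 + 1 : ℝ) ≠ 0 := by positivity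
    have h1 : HasDerivAt (fun y : ℝ => Real.exp (-y ^ 2)) (Real.exp (-y ^ 2) * -(2 * y)) y := by
      simpa using ((hasDerivAt_pow 2 y).neg).exp
    have h2 : HasDerivAt (fun y : ℝ => 2 * y ^ 2 + 1) (2 * (2 * y)) y := by
      simpa using ((hasDerivAt_pow 2 y).const_mul 2).add_const 1
    have h3 := (hasDerivAt_erfc' y).sub
      ((h1.mul ((hasDerivAt_id y).div h2 hy)).const_mul (2 / Real.sqrt Real.pi))
    refine h3.congr_deriv ?_
    have hp : Real.sqrt Real.pi ≠ 0 := by positivity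
    simp only [id, Pi.div_apply]
    field_simp
    ring
  have hanti : Antitone G := antitone_of_hasDerivAt_nonpos hd fun y => by
    refine neg_nonpos.2 ?_
    positivity
  have hlim : Filter.Tendsto G Filter.atTop (nhds 0) := by
    have h1 : Filter.Tendsto
        (fun y : ℝ => 2 / Real.sqrt Real.pi * (Real.exp (-y ^ 2) * (y / (2 * y ^ 2 + 1))))
        Filter.atTop (nhds 0) := by
      have h2 : Filter.Tendsto (fun y : ℝ => Real.exp (-y ^ 2)) Filter.atTop (nhds 0) :=
        Real.tendsto_exp_neg_atTop_nhds_zero.comp (Filter.tendsto_pow_atTop two_ne_zero)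
      have h3 : Filter.Tendsto (fun y : ℝ => Real.exp (-y ^ 2) * (y / (2 * y ^ 2 + 1)))
          Filter.atTop (nhds 0) := by
        refine squeeze_zero' (Filter.eventually_atTop.2 ⟨0, fun y hy => by positivity⟩)
          (Filter.eventually_atTop.2 ⟨0, fun y hy => ?_⟩) h2
        refine mul_le_of_le_one_right (Real.exp_pos _).le ?_
        rw [div_le_one (by positivity)]
        nlinarith [sq_nonneg (y - 1)]
      simpa using h3.const_mul (2 / Real.sqrt Real.pi)
    simpa [hG] using tendsto_erfc'_atTop.sub h1
  have := hanti.le_of_tendsto hlim x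
  simp only [hG] at this
  linarith

lemma erfc'_erfcInv {y : ℝ} (h0 : 0 < y) (h1 : y ≤ 1) : erfc' (erfcInv y) = y := by
  have hcont : Continuous erfc' :=
    continuous_iff_continuousAt.2 fun x => (hasDerivAt_erfc' x).continuousAt
  obtain ⟨a, ha, ha0⟩ := ((tendsto_erfc'_atTop.eventually (gt_mem_nhds h0)).and
    (Filter.eventually_ge_atTop 0)).exists
  obtain ⟨x, hx, hxy⟩ := intermediate_value_Icc' ha0 hcont.continuousOn
    (⟨ha.le, by rwa [erfc'_zero]⟩ : y ∈ Icc (erfc' a) (erfc' 0))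
  exact Function.invFunOn_eq ⟨x, hx.1, hxy⟩

lemma erfc'_le_mul_exp {K d₀ d : ℝ} (h₀ : 0 ≤ d₀) (hd : d₀ ≤ d) (hK : 1 ≤ K)
    (hbd : ∀ t, 0 ≤ t → 1 + 113 / 100 * t ≤ K * Real.exp (d₀ ^ 2 / 4 + d₀ * t)) (x : ℝ) :
    erfc' x ≤ K * Real.exp (d ^ 2 / 4 - d * x) := by
  rcases le_total 0 x with hx | hx
  · calc erfc' x ≤ Real.exp (-x ^ 2) := erfc'_le_exp_neg_sq hx
      _ ≤ Real.exp (d ^ 2 / 4 - d * x) := Real.exp_le_exp.2 (by nlinarith [sq_nonneg (x - d / 2)])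
      _ ≤ _ := le_mul_of_one_le_left (Real.exp_pos _).le hK
  · have hx' : 0 ≤ -x := by linarith
    have h1 : erfc' x ≤ 1 + 113 / 100 * (-x) := by
      have h2 : erfc' x = 1 + erf' (-x) := by rw [erf'_neg, erfc']; ring
      have h3 : ∫ t in (0 : ℝ)..(-x), Real.exp (-t ^ 2) ≤ ∫ _ in (0 : ℝ)..(-x), (1 : ℝ) := by
        refine intervalIntegral.integral_mono_on hx'
          (Continuous.intervalIntegrable (by fun_prop) _ _)
          (Continuous.intervalIntegrable (by fun_prop) _ _) fun t _ => ?_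
        rw [Real.exp_le_one_iff]
        nlinarith [sq_nonneg t]
      have h4 : 2 / Real.sqrt Real.pi ≤ 113 / 100 := by
        rw [div_le_iff₀ (by positivity)]
        linarith [sqrt_pi_bounds.1]
      rw [h2, erf']
      simp only [intervalIntegral.integral_const, sub_zero, smul_eq_mul, mul_one] at h3
      have h5 : 0 ≤ ∫ t in (0 : ℝ)..(-x), Real.exp (-t ^ 2) :=
        intervalIntegral.integral_nonneg hx' fun t _ => (Real.exp_pos _).le
      gcongr
    refine (h1.trans (hbd _ hx')).trans ?_
    have : d₀ ^ 2 / 4 + d₀ * (-x) ≤ d ^ 2 / 4 - d * x := by nlinarith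
    gcongr

lemma erfc'_le_exp {d : ℝ} (hd : 1 ≤ d) (x : ℝ) : erfc' x ≤ Real.exp (d ^ 2 / 4 - d * x) := by
  refine (erfc'_le_mul_exp zero_le_one hd le_rfl (fun t ht => ?_) x).trans_eq (one_mul _)
  rw [Real.exp_add, one_mul, one_mul]
  have h1 := Real.add_one_le_exp ((1 : ℝ) ^ 2 / 4)
  have h2 := Real.add_one_le_exp t
  calc 1 + 113 / 100 * t ≤ ((1 : ℝ) ^ 2 / 4 + 1) * (t + 1) := by linarith
    _ ≤ _ := by gcongr

lemma erfc'_le_exp_of_half_le {d : ℝ} (hd : 1 / 2 ≤ d) (x : ℝ) :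
    erfc' x ≤ 13 / 10 * Real.exp (d ^ 2 / 4 - d * x) := by
  refine erfc'_le_mul_exp (by norm_num) hd (by norm_num) (fun t ht => ?_) x
  rw [Real.exp_add]
  have h1 := Real.add_one_le_exp ((1 / 2 : ℝ) ^ 2 / 4)
  have h2 := Real.quadratic_le_exp_of_nonneg (x := 1 / 2 * t) (by positivity)
  calc 1 + 113 / 100 * t
      ≤ 13 / 10 * (((1 / 2 : ℝ) ^ 2 / 4 + 1) * (1 + 1 / 2 * t + (1 / 2 * t) ^ 2 / 2)) := by
        nlinarith [sq_nonneg (t - 5 / 4)]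
    _ ≤ _ := by gcongr

lemma exp_add_exp_le_erfc' {x : ℝ} (hx : 1 ≤ x) :
    3 * (13 / 20 * Real.exp (-7 * x ^ 2)) + 13 / 20 * Real.exp (-(27 / 16) * x ^ 2) ≤ erfc' x := by
  refine le_trans ?_ (le_erfc' x)
  obtain ⟨w, hw⟩ : ∃ w, w = x ^ 2 - 1 := ⟨_, rfl⟩
  have hw0 : 0 ≤ w := by nlinarith
  have e1 : Real.exp (-7 * x ^ 2) =
      Real.exp (-x ^ 2) * (Real.exp (-6) * Real.exp (-6 * w)) := by
    rw [← Real.exp_add, ← Real.exp_add]; congr 1; rw [hw]; ring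
  have e2 : Real.exp (-(27 / 16) * x ^ 2) =
      Real.exp (-x ^ 2) * (Real.exp (-(11 / 16)) * Real.exp (-(11 / 16) * w)) := by
    rw [← Real.exp_add, ← Real.exp_add]; congr 1; rw [hw]; ring
  have e3 : Real.exp (-6 * w) ≤ Real.exp (-(11 / 16) * w) := Real.exp_le_exp.2 (by nlinarith)
  have n1 : Real.exp (-6) ≤ 1 / 350 := by
    rw [Real.exp_neg, inv_eq_one_div]
    apply one_div_le_one_div_of_le (by norm_num)
    have h := Real.exp_one_gt_d9
    calc (350 : ℝ) ≤ (27 / 10) ^ 6 := by norm_num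
      _ ≤ Real.exp 1 ^ 6 := by gcongr; linarith
      _ = Real.exp 6 := by rw [← Real.exp_nat_mul]; norm_num
  have n2 : Real.exp (-(11 / 16)) ≤ 53 / 100 := by
    have h : (100 / 53 : ℝ) ≤ Real.exp (11 / 16) := by
      refine le_trans ?_ (Real.quadratic_le_exp_of_nonneg (by norm_num))
      norm_num
    rw [Real.exp_neg]
    calc _ ≤ (100 / 53 : ℝ)⁻¹ := by gcongr
      _ = _ := by norm_num
  have n3 : Real.exp (-(11 / 16) * w) ≤ 1 / (1 + 11 / 16 * w) := by
    rw [neg_mul, Real.exp_neg, inv_eq_one_div]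
    apply one_div_le_one_div_of_le (by positivity)
    linarith [Real.add_one_le_exp (11 / 16 * w)]
  have n4 : 1 / (3 + w) ≤ x / (2 * x ^ 2 + 1) := by
    rw [div_le_div_iff₀ (by positivity) (by positivity)]
    have : w = x ^ 2 - 1 := hw
    subst this
    nlinarith [mul_nonneg (sub_nonneg.2 hx) (sub_nonneg.2 hx)]
  have n5 : (112 / 100 : ℝ) ≤ 2 / Real.sqrt Real.pi := by
    rw [le_div_iff₀ (by positivity)]
    linarith [sqrt_pi_bounds.2]
  rw [e1, e2]
  set A := Real.exp (-x ^ 2)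
  set D := Real.exp (-(11 / 16) * w)
  have hA : 0 < A := Real.exp_pos _
  have hD : 0 < D := Real.exp_pos _
  calc 3 * (13 / 20 * (A * (Real.exp (-6) * Real.exp (-6 * w))))
        + 13 / 20 * (A * (Real.exp (-(11 / 16)) * D))
      ≤ 3 * (13 / 20 * (A * (1 / 350 * D))) + 13 / 20 * (A * (53 / 100 * D)) := by gcongr
    _ ≤ A * (36 / 100 * D) := by nlinarith [mul_pos hA hD]
    _ ≤ A * (36 / 100 * (1 / (1 + 11 / 16 * w))) := by gcongr
    _ ≤ A * (112 / 100 * (1 / (3 + w))) := by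
        refine mul_le_mul_of_nonneg_left ?_ hA.le
        rw [mul_one_div, mul_one_div, div_le_div_iff₀ (by positivity) (by positivity)]
        nlinarith
    _ ≤ A * (2 / Real.sqrt Real.pi * (x / (2 * x ^ 2 + 1))) := by gcongr
    _ = _ := by ring

open scoped FourierTransform ContDiff SchwartzMap

lemma integral_fourier_mul_eq_flip {f g : ℝ → ℂ} (hf : Integrable f) (hg : Integrable g) :
    ∫ ξ, 𝓕 f ξ * g ξ = ∫ x, f x * 𝓕 g x := by
  simpa using! VectorFourier.integral_fourierIntegral_smul_eq_flip (L := innerₗ ℝ)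
    Real.continuous_fourierChar continuous_inner hf hg

lemma integral_fourierInv_mul_eq_flip {f g : ℝ → ℂ} (hf : Integrable f) (hg : Integrable g) :
    ∫ ξ, 𝓕⁻ f ξ * g ξ = ∫ x, f x * 𝓕⁻ g x := by
  have h := integral_fourier_mul_eq_flip hf hg.comp_neg
  rw [← Real.fourierInv_eq_fourier_comp_neg] at h
  rw [← h, ← integral_neg_eq_self]
  simp only [Real.fourierInv_eq_fourier_neg, neg_neg]

lemma continuous_fourierInv {f : ℝ → ℂ} (hf : Integrable f) : Continuous (𝓕⁻ f) := by
  have h : Continuous (𝓕 f) := VectorFourier.fourierIntegral_continuous (L := innerₗ ℝ)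
    Real.continuous_fourierChar continuous_inner hf
  rw [show 𝓕⁻ f = fun x => 𝓕 f (-x) from funext fun x => Real.fourierInv_eq_fourier_neg f x]
  exact h.comp continuous_neg

/-- Plancherel for functions in `L¹ ∩ L²`. -/
lemma eLpNorm_fourierInv {f : ℝ → ℂ} (hf : Integrable f) (hf2 : MemLp f 2) :
    eLpNorm (𝓕⁻ f) 2 = eLpNorm f 2 := by
  set G : L2 := 𝓕⁻ hf2.toLp with hG
  have hae : ∀ᵐ x : ℝ, G x = 𝓕⁻ f x := by
    refine ae_eq_of_integral_contDiff_smul_eq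
      ((Lp.memLp G).locallyIntegrable (by norm_num))
      (continuous_fourierInv hf).locallyIntegrable fun φ hφ hφc => ?_
    have hc : HasCompactSupport fun x => (φ x : ℂ) := hφc.comp_left (g := Complex.ofReal) rfl
    have hd : ContDiff ℝ ∞ fun x => (φ x : ℂ) := Complex.ofRealCLM.contDiff.comp hφ
    set ψ : 𝓢(ℝ, ℂ) := hc.toSchwartzMap hd with hψ
    have h1 := congrArg (fun T => T ψ) (Lp.fourierInv_toTemperedDistribution_eq hf2.toLp)
    simp only [TemperedDistribution.fourierInv_apply, Lp.toTemperedDistribution_apply,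
      smul_eq_mul] at h1
    have h2 : ∫ x, (𝓕⁻ ψ : 𝓢(ℝ, ℂ)) x * (hf2.toLp : L2) x = ∫ x, 𝓕⁻ (ψ : ℝ → ℂ) x * f x := by
      refine integral_congr_ae ?_
      filter_upwards [hf2.coeFn_toLp] with x hx
      rw [hx, SchwartzMap.fourierInv_coe]
    rw [h2, integral_fourierInv_mul_eq_flip ψ.integrable hf] at h1
    simpa [hψ, Complex.real_smul] using h1.symm
  rw [← eLpNorm_congr_ae hae, ← eLpNorm_congr_ae hf2.coeFn_toLp]
  have hn : ‖G‖ = ‖hf2.toLp‖ := by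
    rw [← Lp.norm_fourier_eq G, hG, FourierTransform.fourier_fourierInv_eq]
  rw [Lp.norm_def, Lp.norm_def] at hn
  exact (ENNReal.toReal_eq_toReal_iff' (Lp.eLpNorm_ne_top _) (Lp.eLpNorm_ne_top _)).1 hn

/-- A bounded Fourier multiplier is bounded on Schwartz functions for the `L²` norm. -/
lemma eLpNorm_fourierInv_mul_fourier_le {q : ℝ → ℂ} (hq : Continuous q) {C : ℝ}
    (hC : ∀ v, ‖q v‖ ≤ C) (h : 𝓢(ℝ, ℂ)) :
    eLpNorm (𝓕⁻ (fun v => q v * 𝓕 (h : ℝ → ℂ) v)) 2 ≤ ENNReal.ofReal C * eLpNorm h 2 := by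
  have hmeas : AEStronglyMeasurable q volume := hq.aestronglyMeasurable
  have e : 𝓕 (h : ℝ → ℂ) = (𝓕 h : 𝓢(ℝ, ℂ)) := (SchwartzMap.fourier_coe h).symm
  have hle : ∀ᵐ v : ℝ, ‖q v * 𝓕 (h : ℝ → ℂ) v‖ ≤ C * ‖𝓕 (h : ℝ → ℂ) v‖ := .of_forall fun v => by
    rw [norm_mul]
    gcongr
    exact hC v
  have hi : Integrable (fun v => q v * 𝓕 (h : ℝ → ℂ) v) := by
    rw [e]
    exact (𝓕 h : 𝓢(ℝ, ℂ)).integrable.bdd_mul hmeas (.of_forall hC)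
  have h2 : MemLp (fun v => q v * 𝓕 (h : ℝ → ℂ) v) 2 := by
    rw [e] at hle hi ⊢
    exact ((𝓕 h : 𝓢(ℝ, ℂ)).memLp 2).of_le_mul hi.aestronglyMeasurable hle
  rw [eLpNorm_fourierInv hi h2]
  refine (eLpNorm_le_mul_eLpNorm_of_ae_le_mul hle 2).trans_eq ?_
  congr 1
  rw [e]
  have hn := congrArg norm (SchwartzMap.toLp_fourier_eq h)
  rw [Lp.norm_fourier_eq, Lp.norm_def, Lp.norm_def,
    ENNReal.toReal_eq_toReal_iff' (Lp.eLpNorm_ne_top _) (Lp.eLpNorm_ne_top _),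
    eLpNorm_congr_ae (h.coeFn_toLp 2 volume), eLpNorm_congr_ae ((𝓕 h : 𝓢(ℝ, ℂ)).coeFn_toLp 2 volume)] at hn
  exact hn.symm

lemma fourierInv_mul_fourier_eq {q u : ℝ → ℂ} (hq : Integrable q) (hu : Integrable u) (x : ℝ) :
    𝓕⁻ (fun v => q v * 𝓕 u v) x = ∫ y, 𝓕⁻ q (x - y) * u y := by
  have hg : Integrable fun v => ((𝐞 (v * x) : Circle) : ℂ) * q v :=
    hq.bdd_mul (c := 1) (by fun_prop) (.of_forall fun v => (Circle.norm_coe _).le)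
  have h := integral_fourier_mul_eq_flip hu hg
  calc 𝓕⁻ (fun v => q v * 𝓕 u v) x = ∫ v, 𝓕 u v * (((𝐞 (v * x) : Circle) : ℂ) * q v) := by
        rw [Real.fourierInv_eq]
        refine integral_congr_ae (.of_forall fun v => ?_)
        simp only [Circle.smul_def, smul_eq_mul, RCLike.inner_apply, conj_trivial]
        rw [mul_comm x v]
        ring
    _ = _ := h
    _ = _ := by
        refine integral_congr_ae (.of_forall fun y => ?_)
        simp only
        rw [mul_comm]
        congr 1
        rw [Real.fourierInv_eq, Real.fourier_eq]
        refine integral_congr_ae (.of_forall fun v => ?_)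
        simp only [Circle.smul_def, smul_eq_mul, RCLike.inner_apply, conj_trivial]
        rw [← mul_assoc, ← Circle.coe_mul, ← AddChar.map_add_eq_mul]
        congr 3
        ring

/-- The frequency window obtained by smoothing the indicator of `[-b, b]` with a Gaussian,
evaluated at the point `s * v + i * η` of a horizontal line in the complex plane. -/
def gaussWindow (s b η v : ℝ) : ℂ :=
  (1 / Real.sqrt Real.pi : ℝ) *
    ∫ ζ in Icc (-b) b, Complex.exp (-((s * v : ℝ) - ζ + η * Complex.I) ^ 2)

lemma norm_cexp_neg_sq_shift (t η : ℝ) :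
    ‖Complex.exp (-(t + η * Complex.I) ^ 2)‖ = Real.exp (η ^ 2) * Real.exp (-t ^ 2) := by
  rw [Complex.norm_exp, ← Real.exp_add]
  congr 1
  simp [pow_two]
  ring

lemma continuous_gaussWindow (s b η : ℝ) : Continuous (gaussWindow s b η) := by
  unfold gaussWindow
  refine continuous_const.mul ?_
  refine continuous_parametric_integral_of_continuous (by fun_prop) isCompact_Icc

lemma norm_gaussWindow_le (s b η v : ℝ) : ‖gaussWindow s b η v‖ ≤ Real.exp (η ^ 2) := by
  have hp : 0 < Real.sqrt Real.pi := by positivity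
  have hn : ∀ ζ : ℝ, ‖Complex.exp (-((s * v : ℝ) - ζ + η * Complex.I) ^ 2)‖ =
      Real.exp (η ^ 2) * Real.exp (-(s * v - ζ) ^ 2) := fun ζ => by
    rw [← norm_cexp_neg_sq_shift]
    push_cast
    rfl
  have hint : Integrable fun ζ => Real.exp (η ^ 2) * Real.exp (-(s * v - ζ) ^ 2) :=
    (integrable_exp_neg_sq.comp_sub_left (s * v)).const_mul _
  have htot : ∫ ζ, Real.exp (η ^ 2) * Real.exp (-(s * v - ζ) ^ 2) =
      Real.exp (η ^ 2) * Real.sqrt Real.pi := by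
    rw [integral_const_mul, integral_sub_left_eq_self (fun t : ℝ => Real.exp (-t ^ 2))]
    congr 1
    simpa using integral_gaussian 1
  rw [gaussWindow, norm_mul, Complex.norm_real, Real.norm_of_nonneg (by positivity)]
  calc 1 / Real.sqrt Real.pi *
        ‖∫ ζ in Icc (-b) b, Complex.exp (-((s * v : ℝ) - ζ + η * Complex.I) ^ 2)‖
      ≤ 1 / Real.sqrt Real.pi * (Real.exp (η ^ 2) * Real.sqrt Real.pi) := by
        gcongr
        refine (norm_integral_le_integral_norm _).trans ?_
        simp_rw [hn]
        rw [← htot]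
        exact setIntegral_le_integral hint (.of_forall fun ζ => by positivity)
    _ = Real.exp (η ^ 2) := by field_simp

lemma integrable_gaussWindow_kernel {s : ℝ} (hs : 0 < s) (b η : ℝ) :
    Integrable (fun p : ℝ × ℝ => Complex.exp (-((s * p.1 : ℝ) - p.2 + η * Complex.I) ^ 2))
      (volume.prod (volume.restrict (Icc (-b) b))) := by
  have hcont : Continuous
      fun p : ℝ × ℝ => Complex.exp (-((s * p.1 : ℝ) - p.2 + η * Complex.I) ^ 2) := by fun_prop
  have hn : ∀ v ζ : ℝ, ‖Complex.exp (-((s * v : ℝ) - ζ + η * Complex.I) ^ 2)‖ =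
      Real.exp (η ^ 2) * Real.exp (-(s * v - ζ) ^ 2) := fun v ζ => by
    rw [← norm_cexp_neg_sq_shift]
    push_cast
    rfl
  have hint : ∀ ζ : ℝ, Integrable fun v => Real.exp (η ^ 2) * Real.exp (-(s * v - ζ) ^ 2) :=
    fun ζ => ((integrable_exp_neg_sq.comp_sub_right ζ).comp_mul_left' hs.ne').const_mul _
  rw [integrable_prod_iff' hcont.aestronglyMeasurable]
  refine ⟨.of_forall fun ζ => ?_, ?_⟩
  · refine (hint ζ).mono' (by fun_prop) (.of_forall fun v => ?_)
    simp only [hn, le_refl]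
  · simp only [hn]
    have : ∀ ζ : ℝ, ∫ v, Real.exp (η ^ 2) * Real.exp (-(s * v - ζ) ^ 2) =
        Real.exp (η ^ 2) * (|s⁻¹| * Real.sqrt Real.pi) := fun ζ => by
      rw [integral_const_mul, Measure.integral_comp_mul_left
        (fun t : ℝ => Real.exp (-(t - ζ) ^ 2)) s,
        integral_sub_right_eq_self (fun t : ℝ => Real.exp (-t ^ 2)) ζ]
      congr 2
      simpa using integral_gaussian 1
    simp_rw [this]
    exact integrable_const _

lemma integrable_gaussWindow {s : ℝ} (hs : 0 < s) (b η : ℝ) : Integrable (gaussWindow s b η) :=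
  (integrable_gaussWindow_kernel hs b η).integral_prod_left.const_mul _

lemma integral_fourierChar_mul_gaussian {s : ℝ} (hs : 0 < s) (z : ℂ) (u : ℝ) :
    ∫ v : ℝ, Complex.exp (2 * Real.pi * (v * u : ℝ) * Complex.I) *
        Complex.exp (-((s * v : ℝ) - z) ^ 2) =
      (Real.pi / (s : ℂ) ^ 2) ^ (1 / 2 : ℂ) *
        Complex.exp (2 * Real.pi * Complex.I * u * z / s - Real.pi ^ 2 * u ^ 2 / s ^ 2) := by
  have hs' : (s : ℂ) ≠ 0 := by exact_mod_cast hs.ne'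
  have hb : (-(s : ℂ) ^ 2).re < 0 := by
    rw [← Complex.ofReal_pow, Complex.neg_re, Complex.ofReal_re]
    have : 0 < s ^ 2 := by positivity
    linarith
  have h := integral_cexp_quadratic hb (2 * Real.pi * u * Complex.I + 2 * s * z) (-z ^ 2)
  rw [neg_neg] at h
  calc _ = ∫ x : ℝ, Complex.exp (-(s : ℂ) ^ 2 * x ^ 2 +
          (2 * Real.pi * u * Complex.I + 2 * s * z) * x + -z ^ 2) := by
        refine integral_congr_ae (.of_forall fun v => ?_)
        simp only
        rw [← Complex.exp_add]
        congr 1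
        push_cast
        ring
    _ = _ := h
    _ = _ := by
        congr 2
        field_simp
        ring_nf
        simp only [Complex.I_sq]
        ring

/-- Shifting the window in the complex direction multiplies its kernel by an exponential. -/
lemma fourierInv_gaussWindow {s : ℝ} (hs : 0 < s) (b η u : ℝ) :
    𝓕⁻ (gaussWindow s b η) u =
      Real.exp (2 * Real.pi * η / s * u) * 𝓕⁻ (gaussWindow s b 0) u := by
  have key : ∀ η : ℝ, 𝓕⁻ (gaussWindow s b η) u = (1 / Real.sqrt Real.pi : ℝ) *
      ∫ ζ in Icc (-b) b, (Real.pi / (s : ℂ) ^ 2) ^ (1 / 2 : ℂ) *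
        Complex.exp (2 * Real.pi * Complex.I * u * (ζ - η * Complex.I) / s
          - Real.pi ^ 2 * u ^ 2 / s ^ 2) := by
    intro η
    have hswap := integral_integral_swap
      (f := fun v ζ : ℝ => Complex.exp (2 * Real.pi * (v * u : ℝ) * Complex.I) *
        Complex.exp (-((s * v : ℝ) - ζ + η * Complex.I) ^ 2))
      (μ := volume) (ν := volume.restrict (Icc (-b) b)) (by
        refine (integrable_gaussWindow_kernel hs b η).bdd_mul (c := 1)
          (Continuous.aestronglyMeasurable (by fun_prop)) (.of_forall fun p => ?_)
        rw [show (2 * Real.pi * (p.1 * u : ℝ) * Complex.I : ℂ) =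
          (2 * Real.pi * (p.1 * u) : ℝ) * Complex.I by push_cast; ring,
          Complex.norm_exp_ofReal_mul_I])
    rw [Real.fourierInv_eq']
    calc _ = ∫ v : ℝ, (1 / Real.sqrt Real.pi : ℝ) * ∫ ζ in Icc (-b) b,
          Complex.exp (2 * Real.pi * (v * u : ℝ) * Complex.I) *
          Complex.exp (-((s * v : ℝ) - ζ + η * Complex.I) ^ 2) := by
          refine integral_congr_ae (.of_forall fun v => ?_)
          simp only [gaussWindow, RCLike.inner_apply, conj_trivial, smul_eq_mul]
          rw [integral_const_mul, mul_left_comm, mul_comm u v]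
          push_cast
          rfl
      _ = _ := by
          rw [integral_const_mul, hswap]
          congr 1
          refine integral_congr_ae (.of_forall fun ζ => ?_)
          simp only
          rw [← integral_fourierChar_mul_gaussian hs]
          refine integral_congr_ae (.of_forall fun v => ?_)
          simp only
          congr 3
          ring
  rw [key, key, mul_left_comm]
  congr 1
  rw [← integral_const_mul]
  refine integral_congr_ae (.of_forall fun ζ => ?_)
  simp only
  rw [mul_left_comm, Complex.ofReal_exp, ← Complex.exp_add]
  congr 2
  have hs' : (s : ℂ) ≠ 0 := by exact_mod_cast hs.ne'
  push_cast
  field_simp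
  ring_nf
  simp only [Complex.I_sq]
  ring

/-- Exponentially weighted `L²` bound for the multiplier with symbol `gaussWindow s b 0`. -/
lemma eLpNorm_exp_mul_gaussWindow_le {s : ℝ} (hs : 0 < s) (b η : ℝ) {h : ℝ → ℂ}
    (hd : ContDiff ℝ ∞ h) (hc : HasCompactSupport h) :
    eLpNorm (fun x => (Real.exp (2 * Real.pi * η / s * x) : ℂ) *
        𝓕⁻ (fun v => gaussWindow s b 0 v * 𝓕 h v) x) 2 ≤
      ENNReal.ofReal (Real.exp (η ^ 2)) *
        eLpNorm (fun y => (Real.exp (2 * Real.pi * η / s * y) : ℂ) * h y) 2 := by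
  set g : ℝ → ℂ := fun y => (Real.exp (2 * Real.pi * η / s * y) : ℂ) * h y with hg
  have hgd : ContDiff ℝ ∞ g := by
    have hexp : ContDiff ℝ ∞ fun y : ℝ => (Real.exp (2 * Real.pi * η / s * y) : ℂ) :=
      Complex.ofRealCLM.contDiff.comp
        (show ContDiff ℝ ∞ fun y : ℝ => Real.exp (2 * Real.pi * η / s * y) by fun_prop)
    exact hexp.mul hd
  have hgc : HasCompactSupport g := hc.mul_left
  have hgi : Integrable g := hgd.continuous.integrable_of_hasCompactSupport hgc
  have hhi : Integrable h := hd.continuous.integrable_of_hasCompactSupport hc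
  have heq : (fun x => (Real.exp (2 * Real.pi * η / s * x) : ℂ) *
      𝓕⁻ (fun v => gaussWindow s b 0 v * 𝓕 h v) x) =
      𝓕⁻ (fun v => gaussWindow s b η v * 𝓕 g v) := by
    ext x
    rw [fourierInv_mul_fourier_eq (integrable_gaussWindow hs b 0) hhi,
      fourierInv_mul_fourier_eq (integrable_gaussWindow hs b η) hgi, ← integral_const_mul]
    refine integral_congr_ae (.of_forall fun y => ?_)
    simp only [hg]
    rw [fourierInv_gaussWindow hs b η]
    have : Real.exp (2 * Real.pi * η / s * x) =
        Real.exp (2 * Real.pi * η / s * (x - y)) * Real.exp (2 * Real.pi * η / s * y) := by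
      rw [← Real.exp_add]
      congr 1
      ring
    rw [this]
    push_cast
    ring
  rw [heq]
  exact eLpNorm_fourierInv_mul_fourier_le (continuous_gaussWindow s b η)
    (norm_gaussWindow_le s b η) (hgc.toSchwartzMap hgd)

lemma PSc_eq_gaussWindow {kmax σ : ℝ} (hk : 0 < kmax) (hσ : 0 < σ) (j : ℕ) (v : ℝ) :
    (PSc kmax σ j (2 * Real.pi * v) : ℂ) =
      gaussWindow (2 * Real.pi * (2 ^ j * σ)) (σ * (3 * kmax / 8)) 0 v := by
  set b := σ * (3 * kmax / 8) with hb
  set X := 2 * Real.pi * (2 ^ j * σ) * v with hX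
  have hb0 : 0 < b := by positivity
  have h1 : σ * (2 ^ j * (2 * Real.pi * v) + 3 * kmax / 8) = X - -b := by rw [hb, hX]; ring
  have h2 : σ * (2 ^ j * (2 * Real.pi * v) - 3 * kmax / 8) = X - b := by rw [hb, hX]; ring
  have hi : ∀ c d : ℝ, IntervalIntegrable (fun t : ℝ => Real.exp (-t ^ 2)) volume c d :=
    fun c d => Continuous.intervalIntegrable (by fun_prop) c d
  have hreal : PSc kmax σ j (2 * Real.pi * v) =
      1 / Real.sqrt Real.pi * ∫ ζ in Icc (-b) b, Real.exp (-(X - ζ) ^ 2) := by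
    rw [PSc, P0fun, h1, h2, erf', erf', ← mul_sub,
      intervalIntegral.integral_interval_sub_left (hi _ _) (hi _ _),
      ← intervalIntegral.integral_comp_sub_left (fun t : ℝ => Real.exp (-t ^ 2)),
      intervalIntegral.integral_of_le (by linarith), ← integral_Icc_eq_integral_Ioc]
    ring
  rw [hreal, gaussWindow, Complex.ofReal_mul, ← integral_complex_ofReal]
  congr 1
  refine integral_congr_ae (.of_forall fun ζ => ?_)
  simp [hX]

lemma ft_eq (h : ℝ → ℂ) (k : ℝ) :
    ft h k = (Real.sqrt (2 * Real.pi) : ℂ)⁻¹ * 𝓕 h (k / (2 * Real.pi)) := by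
  rw [ft, Real.fourier_real_eq_integral_exp_smul]
  congr 1
  refine integral_congr_ae (.of_forall fun x => ?_)
  have hp : (Real.pi : ℂ) ≠ 0 := by exact_mod_cast Real.pi_ne_zero
  simp only [smul_eq_mul]
  congr 2
  push_cast
  field_simp

lemma integrable_ft (h : 𝓢(ℝ, ℂ)) : Integrable (ft h) := by
  have e : ft h = fun k =>
      (Real.sqrt (2 * Real.pi) : ℂ)⁻¹ * (𝓕 h : 𝓢(ℝ, ℂ)) (k / (2 * Real.pi)) := by
    ext k
    rw [ft_eq, SchwartzMap.fourier_coe]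
  rw [e]
  exact ((𝓕 h : 𝓢(ℝ, ℂ)).integrable.comp_div (by positivity)).const_mul _

lemma ift_mul_ft_eq (p : ℝ → ℂ) (h : ℝ → ℂ) (x : ℝ) :
    ift (fun k => p k * ft h k) x = 𝓕⁻ (fun v => p (2 * Real.pi * v) * 𝓕 h v) x := by
  have hpos : (0 : ℝ) < 2 * Real.pi := by positivity
  have hp : (Real.pi : ℂ) ≠ 0 := by exact_mod_cast Real.pi_ne_zero
  have hs : (Real.sqrt (2 * Real.pi) : ℂ)⁻¹ * (Real.sqrt (2 * Real.pi) : ℂ)⁻¹ =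
      ((2 * Real.pi : ℝ) : ℂ)⁻¹ := by
    rw [← mul_inv, ← Complex.ofReal_mul, Real.mul_self_sqrt hpos.le]
  have hsub := Measure.integral_comp_mul_left (fun k : ℝ => Complex.exp (Complex.I * k * x) *
    (p k * 𝓕 h (k / (2 * Real.pi)))) (2 * Real.pi)
  rw [ift]
  simp only [ft_eq]
  calc _ = ((2 * Real.pi : ℝ) : ℂ)⁻¹ * ∫ k : ℝ, Complex.exp (Complex.I * k * x) *
        (p k * 𝓕 h (k / (2 * Real.pi))) := by
        rw [← hs, mul_assoc]
        congr 1
        rw [← integral_const_mul]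
        refine integral_congr_ae (.of_forall fun k => ?_)
        ring
    _ = _ := by
        rw [abs_of_pos (inv_pos.2 hpos), Complex.real_smul, Complex.ofReal_inv] at hsub
        rw [← hsub, Real.fourierInv_eq']
        refine integral_congr_ae (.of_forall fun v => ?_)
        simp only [smul_eq_mul, RCLike.inner_apply, conj_trivial]
        rw [mul_div_cancel_left₀ v hpos.ne']
        congr 2
        push_cast
        ring

lemma IsMultOp.ae_eq {kmax σ : ℝ} (hk : 0 < kmax) (hσ : 0 < σ) {j : ℕ} {P : L2 →L[ℂ] L2}
    (hP : IsMultOp (PSc kmax σ j) P) {f : L2} {h : ℝ → ℂ} (hfh : f =ᵐ[volume] h)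
    (hd : ContDiff ℝ ∞ h) (hc : HasCompactSupport h) :
    (P f : ℝ → ℂ) =ᵐ[volume] 𝓕⁻ (fun v =>
      gaussWindow (2 * Real.pi * (2 ^ j * σ)) (σ * (3 * kmax / 8)) 0 v * 𝓕 h v) := by
  have hft : ft f = ft h := by
    ext k
    rw [ft, ft]
    congr 1
    refine integral_congr_ae ?_
    filter_upwards [hfh] with x hx
    rw [hx]
  have hi : Integrable h := hd.continuous.integrable_of_hasCompactSupport hc
  have := hP f (hi.congr hfh.symm) (by rw [hft]; exact integrable_ft (hc.toSchwartzMap hd))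
  rw [hft] at this
  refine this.trans (.of_forall fun x => ?_)
  rw [ift_mul_ft_eq (fun k => (PSc kmax σ j k : ℂ))]
  simp only [PSc_eq_gaussWindow hk hσ]

lemma L2.norm_le_of_ae {f g : L2} {F : ℝ → ℂ} {C : ℝ} (hC : 0 ≤ C) (hg : g =ᵐ[volume] F)
    (h : eLpNorm F 2 ≤ ENNReal.ofReal C * eLpNorm f 2) : ‖g‖ ≤ C * ‖f‖ := by
  rw [Lp.norm_def, Lp.norm_def, eLpNorm_congr_ae hg, ← ENNReal.toReal_ofReal hC,
    ← ENNReal.toReal_mul]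
  exact ENNReal.toReal_mono (ENNReal.mul_ne_top ENNReal.ofReal_ne_top (Lp.eLpNorm_ne_top _)) h

lemma L2.opNorm_le_of_smooth {T : L2 →L[ℂ] L2} {C : ℝ} (hC : 0 ≤ C)
    (h : ∀ (f : L2) (u : ℝ → ℂ), f =ᵐ[volume] u → ContDiff ℝ ∞ u → HasCompactSupport u →
      ‖T f‖ ≤ C * ‖f‖) : ‖T‖ ≤ C := by
  refine T.opNorm_le_bound hC fun f => ?_
  refine (Lp.dense_hasCompactSupport_contDiff (F := ℂ) (μ := (volume : Measure ℝ))
    (p := 2) (by norm_num)).induction (P := fun f => ‖T f‖ ≤ C * ‖f‖) ?_ ?_ f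
  · rintro f ⟨u, hu, hc, hd⟩
    exact h f u hu hd hc
  · exact isClosed_le (by fun_prop) (by fun_prop)

lemma IsMulBy.norm_le {c : ℝ → ℝ} {T : L2 →L[ℂ] L2} (h : IsMulBy c T) {C : ℝ} (hC : 0 ≤ C)
    (hc : ∀ x, |c x| ≤ C) : ‖T‖ ≤ C := by
  refine T.opNorm_le_bound hC fun f => Lp.norm_le_mul_norm_of_ae_le_mul ?_
  filter_upwards [h f] with x hx
  rw [hx, norm_mul, Complex.norm_real]
  exact mul_le_mul_of_nonneg_right (hc x) (norm_nonneg _)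

lemma IsMulBy.one_sub {c : ℝ → ℝ} {T : L2 →L[ℂ] L2} (h : IsMulBy c T) :
    IsMulBy (fun x => 1 - c x) (1 - T) := by
  intro f
  rw [sub_apply, one_apply_eq_self]
  filter_upwards [h f, Lp.coeFn_sub f (T f)] with x h1 h2
  rw [h2, Pi.sub_apply, h1]
  push_cast
  ring

lemma IsMulBy.comp {c c' : ℝ → ℝ} {T T' : L2 →L[ℂ] L2} (h : IsMulBy c T) (h' : IsMulBy c' T') :
    IsMulBy (fun x => c x * c' x) (T.comp T') := by
  intro f
  rw [ContinuousLinearMap.comp_apply]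
  filter_upwards [h (T' f), h' f] with x h1 h2
  rw [h1, h2]
  push_cast
  ring

/-- An exponentially weighted `L²` bound persists between exponentially small factors. -/
lemma eLpNorm_mul_le_of_weighted {φ : ℝ → ℝ} {W h u : ℝ → ℂ} {w : ℝ → ℝ} {A C M : ℝ}
    (hA : 0 ≤ A) (hC : 0 ≤ C)
    (hW : eLpNorm (fun x => (Real.exp (φ x) : ℂ) * W x) 2 ≤
      ENNReal.ofReal C * eLpNorm (fun y => (Real.exp (φ y) : ℂ) * h y) 2)
    (hw : ∀ x, |w x| ≤ A * Real.exp (φ x))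
    (hu : ∀ y, ‖h y‖ ≤ M * Real.exp (-φ y) * ‖u y‖) :
    eLpNorm (fun x => (w x : ℂ) * W x) 2 ≤ ENNReal.ofReal (A * C * M) * eLpNorm u 2 := by
  have h1 : eLpNorm (fun x => (w x : ℂ) * W x) 2 ≤
      ENNReal.ofReal A * eLpNorm (fun x => (Real.exp (φ x) : ℂ) * W x) 2 := by
    refine eLpNorm_le_mul_eLpNorm_of_ae_le_mul (.of_forall fun x => ?_) 2
    rw [norm_mul, norm_mul, ← mul_assoc, Complex.norm_real, Complex.norm_real,
      Real.norm_of_nonneg (Real.exp_pos _).le]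
    exact mul_le_mul_of_nonneg_right (hw x) (norm_nonneg _)
  have h2 : eLpNorm (fun y => (Real.exp (φ y) : ℂ) * h y) 2 ≤
      ENNReal.ofReal M * eLpNorm u 2 := by
    refine eLpNorm_le_mul_eLpNorm_of_ae_le_mul (.of_forall fun y => ?_) 2
    rw [norm_mul, Complex.norm_real, Real.norm_of_nonneg (Real.exp_pos _).le]
    calc _ ≤ Real.exp (φ y) * (M * Real.exp (-φ y) * ‖u y‖) :=
          mul_le_mul_of_nonneg_left (hu y) (Real.exp_pos _).le
      _ = (Real.exp (φ y) * Real.exp (-φ y)) * (M * ‖u y‖) := by ring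
      _ = _ := by rw [← Real.exp_add]; simp
  rw [ENNReal.ofReal_mul (mul_nonneg hA hC), ENNReal.ofReal_mul hA, mul_assoc, mul_assoc]
  refine h1.trans ?_
  gcongr
  refine hW.trans ?_
  gcongr

/-- Weighted bound for `gaussWindow` multipliers sandwiched between exponentially small factors. -/
lemma eLpNorm_mul_gaussWindow_le {τ : ℝ} (hτ : 0 < τ) (b η : ℝ) {h u : ℝ → ℂ} {w : ℝ → ℝ}
    {A M : ℝ} (hA : 0 ≤ A) (hd : ContDiff ℝ ∞ h) (hc : HasCompactSupport h)
    (hw : ∀ x, |w x| ≤ A * Real.exp (η * (x / τ)))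
    (hu : ∀ y, ‖h y‖ ≤ M * Real.exp (-(η * (y / τ))) * ‖u y‖) :
    eLpNorm (fun x => (w x : ℂ) *
        𝓕⁻ (fun v => gaussWindow (2 * Real.pi * τ) b 0 v * 𝓕 h v) x) 2 ≤
      ENNReal.ofReal (A * Real.exp (η ^ 2) * M) * eLpNorm u 2 := by
  have hs : 0 < 2 * Real.pi * τ := by positivity
  have he : ∀ x : ℝ, 2 * Real.pi * η / (2 * Real.pi * τ) * x = η * (x / τ) := fun x => by
    field_simp
  have key := eLpNorm_exp_mul_gaussWindow_le hs b η hd hc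
  simp only [he] at key
  exact eLpNorm_mul_le_of_weighted hA (Real.exp_pos _).le key hw hu

lemma IsMultOp.norm_le_one {kmax σ : ℝ} (hk : 0 < kmax) (hσ : 0 < σ) {j : ℕ} {P : L2 →L[ℂ] L2}
    (hP : IsMultOp (PSc kmax σ j) P) : ‖P‖ ≤ 1 := by
  refine L2.opNorm_le_of_smooth zero_le_one fun f u hfu hd hc => ?_
  refine L2.norm_le_of_ae zero_le_one (hP.ae_eq hk hσ hfu hd hc) ?_
  have h := eLpNorm_mul_gaussWindow_le (τ := 2 ^ j * σ) (by positivity) (σ * (3 * kmax / 8)) 0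
    (u := u) (w := fun _ => 1) zero_le_one (M := 1) hd hc (by simp) (by simp)
  rw [eLpNorm_congr_ae hfu]
  simpa using h

lemma contDiff_chiSc (L σ : ℝ) (m : ℕ) : ContDiff ℝ ∞ (chiSc L σ m) := by
  have h : ContDiff ℝ ∞ erf' := contDiff_erf'
  unfold chiSc chi0
  fun_prop

lemma chiSc_neg (L σ : ℝ) (m : ℕ) (x : ℝ) : chiSc L σ m (-x) = chiSc L σ m x := by
  have h1 : (-x / 2 ^ m + 3 * L / 4) / σ = -((x / 2 ^ m - 3 * L / 4) / σ) := by ring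
  have h2 : (-x / 2 ^ m - 3 * L / 4) / σ = -((x / 2 ^ m + 3 * L / 4) / σ) := by ring
  rw [chiSc, chiSc, chi0, chi0, h1, h2, erf'_neg, erf'_neg]
  ring

lemma one_sub_chiSc (L σ : ℝ) (m : ℕ) (x : ℝ) :
    1 - chiSc L σ m x = 1 / 2 * erfc' (3 * L / (4 * σ) - x / (2 ^ m * σ)) +
      1 / 2 * erfc' (3 * L / (4 * σ) - -x / (2 ^ m * σ)) := by
  have h1 : (x / 2 ^ m + 3 * L / 4) / σ = 3 * L / (4 * σ) - -x / (2 ^ m * σ) := by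
    rw [add_div, div_div, div_div]; ring
  have h2 : (x / 2 ^ m - 3 * L / 4) / σ = -(3 * L / (4 * σ) - x / (2 ^ m * σ)) := by
    rw [sub_div, div_div, div_div]; ring
  rw [chiSc, chi0, h1, h2, erf'_neg, erfc', erfc']
  ring

lemma chiSc_le_one (L σ : ℝ) (m : ℕ) (x : ℝ) : chiSc L σ m x ≤ 1 := by
  linarith [one_sub_chiSc L σ m x, erfc'_nonneg (3 * L / (4 * σ) - x / (2 ^ m * σ)),
    erfc'_nonneg (3 * L / (4 * σ) - -x / (2 ^ m * σ))]

lemma chiSc_nonneg {L σ : ℝ} (hL : 0 < L) (hσ : 0 < σ) (m : ℕ) (x : ℝ) : 0 ≤ chiSc L σ m x := by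
  have h : erfc' ((x / 2 ^ m + 3 * L / 4) / σ) ≤ erfc' ((x / 2 ^ m - 3 * L / 4) / σ) := by
    refine erfc'_strictAnti.antitone ?_
    gcongr
    linarith
  simp only [erfc'] at h
  rw [chiSc, chi0]
  linarith

lemma abs_chiSc_le_one {L σ : ℝ} (hL : 0 < L) (hσ : 0 < σ) (m : ℕ) (x : ℝ) :
    |chiSc L σ m x| ≤ 1 := by
  rw [abs_of_nonneg (chiSc_nonneg hL hσ m x)]
  exact chiSc_le_one L σ m x

/-- Exponential decay of a cutoff at a smaller scale, measured at the larger scale. -/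
lemma chiSc_le_exp {L σ d : ℝ} (hσ : 0 < σ) (hB : 6 ≤ 3 * L / (4 * σ)) (hd : 1 ≤ d) {m j : ℕ}
    (hmj : m < j) (y : ℝ) :
    chiSc L σ m y ≤ 13 / 20 * Real.exp (d ^ 2 / 16 + d * (3 * L / (4 * σ)) / 2) *
      Real.exp (-(d * (y / (2 ^ j * σ)))) := by
  set B := 3 * L / (4 * σ)
  have hj : (2 : ℝ) * 2 ^ m ≤ 2 ^ j := by
    rw [← pow_succ']
    exact pow_le_pow_right₀ one_le_two hmj
  rw [mul_assoc, ← Real.exp_add]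
  rcases le_total y 0 with hy | hy
  · refine (chiSc_le_one L σ m y).trans ?_
    have h1 : y / (2 ^ j * σ) ≤ 0 := div_nonpos_of_nonpos_of_nonneg hy (by positivity)
    have h2 : 3 ≤ d ^ 2 / 16 + d * B / 2 + -(d * (y / (2 ^ j * σ))) := by nlinarith
    linarith [Real.add_one_le_exp (d ^ 2 / 16 + d * B / 2 + -(d * (y / (2 ^ j * σ))))]
  · have h1 : 2 * (y / (2 ^ j * σ)) ≤ y / (2 ^ m * σ) := by
      rw [← mul_div_assoc, div_le_div_iff₀ (by positivity) (by positivity)]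
      nlinarith [mul_le_mul_of_nonneg_left hj (mul_nonneg hy hσ.le)]
    have h2 : chiSc L σ m y ≤ 1 / 2 * erfc' (y / (2 ^ m * σ) - B) := by
      have e := erfc'_neg (B - y / (2 ^ m * σ))
      rw [neg_sub] at e
      linarith [one_sub_chiSc L σ m y, erfc'_nonneg (B - -y / (2 ^ m * σ))]
    have h3 : erfc' (y / (2 ^ m * σ) - B) ≤ erfc' (2 * (y / (2 ^ j * σ)) - B) :=
      erfc'_strictAnti.antitone (by linarith)
    have h4 := erfc'_le_exp_of_half_le (d := d / 2) (by linarith) (2 * (y / (2 ^ j * σ)) - B)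
    have h5 : (d / 2) ^ 2 / 4 - d / 2 * (2 * (y / (2 ^ j * σ)) - B) =
        d ^ 2 / 16 + d * B / 2 + -(d * (y / (2 ^ j * σ))) := by ring
    rw [h5] at h4
    linarith

lemma erfc'_sub_mul_chiSc_le {L σ e : ℝ} (hσ : 0 < σ) (he : 1 ≤ e)
    (hB : 6 * e ≤ 3 * L / (4 * σ)) {m j : ℕ} (hmj : m < j) (x : ℝ) :
    erfc' (3 * L / (4 * σ) - x / (2 ^ j * σ)) * chiSc L σ m x ≤
      13 / 20 * Real.exp (-7 * e ^ 2) := by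
  have h1 := erfc'_le_exp (d := 4 * e) (by linarith) (3 * L / (4 * σ) - x / (2 ^ j * σ))
  have h2 := chiSc_le_exp (d := 4 * e) hσ (le_trans (by linarith) hB) (by linarith) hmj x
  set B := 3 * L / (4 * σ)
  set X := x / (2 ^ j * σ)
  calc _ ≤ Real.exp ((4 * e) ^ 2 / 4 - 4 * e * (B - X)) * (13 / 20 *
        Real.exp ((4 * e) ^ 2 / 16 + 4 * e * B / 2) * Real.exp (-(4 * e * X))) :=
        (mul_le_mul_of_nonneg_left h2 (erfc'_nonneg _)).trans
          (mul_le_mul_of_nonneg_right h1 (by positivity))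
    _ = 13 / 20 * Real.exp (5 * e ^ 2 - 2 * e * B) := by
        have : Real.exp (5 * e ^ 2 - 2 * e * B) = Real.exp ((4 * e) ^ 2 / 4 - 4 * e * (B - X)) *
            Real.exp ((4 * e) ^ 2 / 16 + 4 * e * B / 2) * Real.exp (-(4 * e * X)) := by
          rw [← Real.exp_add, ← Real.exp_add]
          congr 1
          ring
        rw [this, mul_left_comm, mul_assoc]
        ac_rfl
    _ ≤ _ := by
        gcongr
        nlinarith

lemma abs_one_sub_chiSc_mul_chiSc_le {L σ e : ℝ} (hL : 0 < L) (hσ : 0 < σ) (he : 1 ≤ e)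
    (hB : 6 * e ≤ 3 * L / (4 * σ)) {m j : ℕ} (hmj : m < j) (x : ℝ) :
    |(1 - chiSc L σ j x) * chiSc L σ m x| ≤ 13 / 20 * Real.exp (-7 * e ^ 2) := by
  have h1 := erfc'_sub_mul_chiSc_le hσ he hB hmj x
  have h2 := erfc'_sub_mul_chiSc_le hσ he hB hmj (-x)
  rw [chiSc_neg] at h2
  rw [abs_of_nonneg (mul_nonneg (sub_nonneg.2 (chiSc_le_one _ _ _ _)) (chiSc_nonneg hL hσ m x)),
    one_sub_chiSc]
  linarith

lemma norm_one_sub_comp_comp_le {L kmax σ e : ℝ} (hL : 0 < L) (hk : 0 < kmax) (hσ : 0 < σ) (he : 1 ≤ e)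
    (hB : 6 * e ≤ 3 * L / (4 * σ)) {m j : ℕ} (hmj : m < j) {Xj Xm P : L2 →L[ℂ] L2}
    (hXj : IsMulBy (chiSc L σ j) Xj) (hXm : IsMulBy (chiSc L σ m) Xm)
    (hP : IsMultOp (PSc kmax σ j) P) :
    ‖(1 - Xj).comp (P.comp Xm)‖ ≤ 13 / 20 * Real.exp (-(27 / 16) * e ^ 2) := by
  refine L2.opNorm_le_of_smooth (by positivity) fun f u hfu hd hc => ?_
  set h : ℝ → ℂ := fun y => (chiSc L σ m y : ℂ) * u y with hh
  have hhd : ContDiff ℝ ∞ h := (Complex.ofRealCLM.contDiff.comp (contDiff_chiSc L σ m)).mul hd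
  have hhc : HasCompactSupport h := hc.mul_left
  have hXf : Xm f =ᵐ[volume] h := by
    filter_upwards [hXm f, hfu] with x h1 h2
    rw [h1, h2]
  have hPX := hP.ae_eq hk hσ hXf hhd hhc
  set B := 3 * L / (4 * σ) with hBdef
  set τ := 2 ^ j * σ with hτ
  have hτ0 : 0 < τ := by positivity
  set W := 𝓕⁻ (fun v => gaussWindow (2 * Real.pi * τ) (σ * (3 * kmax / 8)) 0 v * 𝓕 h v) with hW
  have hae : (1 - Xj).comp (P.comp Xm) f =ᵐ[volume]
      (fun x => ((1 / 2 * erfc' (B - x / τ) : ℝ) : ℂ) * W x) +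
        fun x => ((1 / 2 * erfc' (B - -x / τ) : ℝ) : ℂ) * W x := by
    filter_upwards [hXj.one_sub (P (Xm f)), hPX] with x h1 h2
    rw [ContinuousLinearMap.comp_apply, ContinuousLinearMap.comp_apply, h1, h2, one_sub_chiSc,
      Complex.ofReal_add, add_mul, Pi.add_apply]
  refine L2.norm_le_of_ae (by positivity) hae ?_
  have hi : Integrable fun v =>
      gaussWindow (2 * Real.pi * τ) (σ * (3 * kmax / 8)) 0 v * 𝓕 h v := by
    have e0 : 𝓕 h = (𝓕 (hhc.toSchwartzMap hhd) : 𝓢(ℝ, ℂ)) :=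
      (SchwartzMap.fourier_coe (hhc.toSchwartzMap hhd)).symm
    rw [e0]
    exact (SchwartzMap.integrable _).bdd_mul (continuous_gaussWindow _ _ _).aestronglyMeasurable
      (.of_forall (norm_gaussWindow_le _ _ _))
  have hWc : Continuous W := continuous_fourierInv hi
  have herfc : Continuous erfc' :=
    continuous_iff_continuousAt.2 fun x => (hasDerivAt_erfc' x).continuousAt
  set A := 1 / 2 * Real.exp (e ^ 2 / 4 - e * B) with hA
  set M := 13 / 20 * Real.exp (e ^ 2 / 16 + e * B / 2) with hM
  have hside : ∀ ε : ℝ, ε ^ 2 = 1 →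
      eLpNorm (fun x => ((1 / 2 * erfc' (B - ε * x / τ) : ℝ) : ℂ) * W x) 2 ≤
        ENNReal.ofReal (A * Real.exp ((ε * e) ^ 2) * M) * eLpNorm u 2 := by
    intro ε hε
    refine eLpNorm_mul_gaussWindow_le hτ0 _ (ε * e) (by positivity) hhd hhc
      (fun x => ?_) fun y => ?_
    · have := erfc'_le_exp he (B - ε * x / τ)
      rw [abs_of_nonneg (by linarith [erfc'_nonneg (B - ε * x / τ)]), hA, mul_assoc,
        ← Real.exp_add,
        show e ^ 2 / 4 - e * B + ε * e * (x / τ) = e ^ 2 / 4 - e * (B - ε * x / τ) by ring]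
      linarith
    · have h1 := chiSc_le_exp hσ (le_trans (by linarith) hB) he hmj (ε * y)
      have h2 : chiSc L σ m (ε * y) = chiSc L σ m y := by
        rcases mul_self_eq_one_iff.1 ((sq ε).symm.trans hε) with rfl | rfl
        · rw [one_mul]
        · rw [neg_one_mul, chiSc_neg]
      rw [hh, norm_mul, Complex.norm_real, Real.norm_of_nonneg (chiSc_nonneg hL hσ m y)]
      refine mul_le_mul_of_nonneg_right ?_ (norm_nonneg _)
      rw [← h2, show ε * e * (y / τ) = e * (ε * y / τ) by ring]
      exact h1
  have hp := hside 1 (by norm_num)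
  have hn := hside (-1) (by norm_num)
  simp only [one_mul, neg_one_mul, neg_sq] at hp hn
  rw [eLpNorm_congr_ae hfu]
  refine (eLpNorm_add_le (Continuous.aestronglyMeasurable (by fun_prop))
    (Continuous.aestronglyMeasurable (by fun_prop)) one_le_two).trans ?_
  refine (add_le_add hp hn).trans ?_
  rw [← add_mul, ← ENNReal.ofReal_add (by positivity) (by positivity)]
  gcongr
  calc A * Real.exp (e ^ 2) * M + A * Real.exp (e ^ 2) * M
      = 13 / 20 * Real.exp (21 / 16 * e ^ 2 - e * B / 2) := by
        have : Real.exp (21 / 16 * e ^ 2 - e * B / 2) = Real.exp (e ^ 2 / 4 - e * B) *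
            Real.exp (e ^ 2) * Real.exp (e ^ 2 / 16 + e * B / 2) := by
          rw [← Real.exp_add, ← Real.exp_add]
          congr 1
          ring
        rw [this, hA, hM]
        generalize Real.exp (e ^ 2 / 4 - e * B) = a
        generalize Real.exp (e ^ 2) = b
        generalize Real.exp (e ^ 2 / 16 + e * B / 2) = c
        ring
    _ ≤ _ := by
        gcongr
        nlinarith

/-- Operator norm bound for [(1−Pⱼ) − χⱼ(1−Pⱼ)χⱼ] ∘ [χₘ Pₘ χₘ] when m < j. -/
theorem stmt6 (L kmax σ δ₁ : ℝ) (hL : 0 < L) (hk : 0 < kmax) (hσ : 0 < σ)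
    (hδpos : 0 < δ₁) (hδle : δ₁ ≤ erfc' 1)
    (hσlo : 8 * erfcInv δ₁ / kmax ≤ σ) (hσhi : σ ≤ L / (8 * erfcInv δ₁))
    (X P : ℕ → (L2 →L[ℂ] L2))
    (hX : ∀ m, IsMulBy (chiSc L σ m) (X m)) (hP : ∀ m, IsMultOp (PSc kmax σ m) (P m))
    (m j : ℕ) (hmj : m < j) :
    ‖(((1 - P j) - (X j).comp ((1 - P j).comp (X j))).comp
        ((X m).comp ((P m).comp (X m))))‖
      ≤ (1 + 15 * kmax / (4 * 2^j)) * δ₁ := by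
  have hE := erfc'_erfcInv hδpos
    (hδle.trans ((erfc'_strictAnti.antitone zero_le_one).trans_eq erfc'_zero))
  set E := erfcInv δ₁
  have hE1 : 1 ≤ E := by
    rw [← erfc'_strictAnti.le_iff_ge, hE]
    exact hδle
  have hB : 6 * E ≤ 3 * L / (4 * σ) := by
    rw [le_div_iff₀ (by positivity)] at hσhi ⊢
    linarith
  set ε := 13 / 20 * Real.exp (-7 * E ^ 2) with hε
  have hε0 : 0 ≤ ε := by positivity
  have hXn : ∀ i, ‖X i‖ ≤ 1 := fun i => (hX i).norm_le zero_le_one (abs_chiSc_le_one hL hσ i)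
  have hPn : ∀ i, ‖P i‖ ≤ 1 := fun i => (hP i).norm_le_one hk hσ
  have hXX : ‖(1 - X j) * X m‖ ≤ ε := ((hX j).one_sub.comp (hX m)).norm_le hε0
    (abs_one_sub_chiSc_mul_chiSc_le hL hσ hE1 hB hmj)
  have hXPX : ‖(1 - X j) * (P j * X m)‖ ≤ 13 / 20 * Real.exp (-(27 / 16) * E ^ 2) :=
    norm_one_sub_comp_comp_le hL hk hσ hE1 hB hmj (hX j) (hX m) (hP j)
  have hQ : ‖1 - P j‖ ≤ 2 := by
    have h1 : ‖(1 : L2 →L[ℂ] L2)‖ ≤ 1 := ContinuousLinearMap.norm_id_le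
    linarith [norm_sub_le (1 : L2 →L[ℂ] L2) (P j), hPn j]
  have hT : ‖(1 - X j) * X m - (1 - X j) * (P j * X m) +
      X j * ((1 - P j) * ((1 - X j) * X m))‖ ≤ δ₁ := by
    have h1 : ‖X j * ((1 - P j) * ((1 - X j) * X m))‖ ≤ 1 * (2 * ε) :=
      norm_mul_le_of_le (hXn j) (norm_mul_le_of_le hQ hXX)
    have h2 := exp_add_exp_le_erfc' hE1
    rw [hE] at h2
    refine (norm_add_le _ _).trans ?_
    linarith [norm_sub_le ((1 - X j) * X m) ((1 - X j) * (P j * X m))]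
  have hPX : ‖P m * X m‖ ≤ 1 * 1 := norm_mul_le_of_le (hPn m) (hXn m)
  have heq : ((1 - P j) - (X j).comp ((1 - P j).comp (X j))).comp
      ((X m).comp ((P m).comp (X m))) = ((1 - X j) * X m - (1 - X j) * (P j * X m) +
      X j * ((1 - P j) * ((1 - X j) * X m))) * (P m * X m) := by
    change (1 - P j - X j * ((1 - P j) * X j)) * (X m * (P m * X m)) = _
    noncomm_ring
  rw [heq]
  refine (norm_mul_le_of_le hT hPX).trans ?_
  have : 0 ≤ 15 * kmax / (4 * 2 ^ j) * δ₁ := by positivity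
  linarith

end
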